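/- arXiv:1002.2485 — 5 statements merged into one kernel-verified Lean document; each statement's English description precedes it below -/
import Mathlib

section
/- Let q, t, z, w be independent indeterminates over ℚ and work in the rational function field ℚ(q,t,z,w). For every natural number θ one has ∏_{1≤i<j≤θ} γ₊(q^{-i}z, q^{-j}w; q,t) = ((1 − t·z/w)/(1 − q·z/w))^θ · (q·z/w; q)_θ / (t·z/w; q)_θ. -/
noncomputable section

/-- The field ℚ(q,t,z,w) of rational functions in four independent
indeterminates over ℚ. -/
abbrev K : Type := FractionRing (MvPolynomial (Fin 4) ℚ)

def q : K := algebraMap (MvPolynomial (Fin 4) ℚ) K (MvPolynomial.X 0)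
def t : K := algebraMap (MvPolynomial (Fin 4) ℚ) K (MvPolynomial.X 1)
def z : K := algebraMap (MvPolynomial (Fin 4) ℚ) K (MvPolynomial.X 2)
def w : K := algebraMap (MvPolynomial (Fin 4) ℚ) K (MvPolynomial.X 3)

/-- The q-Pochhammer symbol `(u;q)_n = ∏_{i=0}^{n-1} (1 - qⁱ u)`. -/
def qPoch (q u : K) (n : ℕ) : K := ∏ i ∈ Finset.range n, (1 - q ^ i * u)

/-- `γ₊(z,w;q,t) = (z - q⁻¹w)(z - q t⁻¹ w)/((z - w)(z - t⁻¹ w))`. -/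
def gammaPlus (q t zz ww : K) : K :=
  (zz - q⁻¹ * ww) * (zz - q * t⁻¹ * ww) / ((zz - ww) * (zz - t⁻¹ * ww))

theorem algebraMap_X_ne_zero (i : Fin 4) :
    algebraMap (MvPolynomial (Fin 4) ℚ) K (MvPolynomial.X i) ≠ 0 := by
  rw [Ne, FaithfulSMul.algebraMap_eq_zero_iff]
  exact MvPolynomial.X_ne_zero i

theorem q_ne_zero : q ≠ 0 := algebraMap_X_ne_zero 0

theorem t_ne_zero : t ≠ 0 := algebraMap_X_ne_zero 1

theorem w_ne_zero : w ≠ 0 := algebraMap_X_ne_zero 3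

theorem w_sub_q_pow_mul_t_pow_mul_z_ne_zero (n m : ℕ) : w - q ^ n * t ^ m * z ≠ 0 := by
  have h : w - q ^ n * t ^ m * z = algebraMap (MvPolynomial (Fin 4) ℚ) K
      (MvPolynomial.X 3 - MvPolynomial.X 0 ^ n * MvPolynomial.X 1 ^ m * MvPolynomial.X 2) := by
    simp only [map_sub, map_mul, map_pow, q, t, z, w]
  rw [h, Ne, FaithfulSMul.algebraMap_eq_zero_iff]
  intro h0
  have := congrArg (MvPolynomial.eval (fun i : Fin 4 => if i = 3 then (1 : ℚ) else 0)) h0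
  simp at this

theorem one_sub_q_pow_mul_ne_zero (n : ℕ) : 1 - q ^ n * (z / w) ≠ 0 := by
  have h := w_sub_q_pow_mul_t_pow_mul_z_ne_zero n 0
  have hw := w_ne_zero
  contrapose! h
  field_simp at h
  linear_combination h

theorem one_sub_t_mul_q_pow_mul_ne_zero (n : ℕ) : 1 - t * q ^ n * (z / w) ≠ 0 := by
  have h := w_sub_q_pow_mul_t_pow_mul_z_ne_zero n 1
  have hw := w_ne_zero
  contrapose! h
  field_simp at h
  linear_combination h

/-- The factor `γ₊(q⁻ⁱz, q⁻ʲw)` depends only on `j - i`, and is a ratio of consecutive terms. -/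
theorem gammaPlus_q_inv_pow (i d : ℕ) :
    gammaPlus q t (q⁻¹ ^ i * z) (q⁻¹ ^ (i + (d + 1)) * w) =
      (1 - q ^ (d + 2) * (z / w)) * (1 - t * q ^ d * (z / w)) /
        ((1 - q ^ (d + 1) * (z / w)) * (1 - t * q ^ (d + 1) * (z / w))) := by
  have hq := q_ne_zero
  have ht := t_ne_zero
  have hw := w_ne_zero
  obtain ⟨x, hx⟩ : ∃ x, z = x * w := ⟨z / w, by field_simp⟩
  have hxw : z / w = x := by rw [hx]; field_simp
  have h1 := one_sub_q_pow_mul_ne_zero (d + 1)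
  have h2 := one_sub_t_mul_q_pow_mul_ne_zero (d + 1)
  rw [hxw] at h1 h2 ⊢
  rw [gammaPlus, hx]
  set c := q⁻¹ ^ (i + (d + 1)) * w with hc
  have hc0 : c ≠ 0 := by positivity
  have e : q⁻¹ ^ i * (x * w) = c * (q ^ (d + 1) * x) := by
    rw [hc, pow_add, inv_pow q (d + 1)]
    field_simp
  have e1 : c * (q ^ (d + 1) * x) - q⁻¹ * c = -(c * q⁻¹) * (1 - q ^ (d + 2) * x) := by
    field_simp
    ring
  have e2 : c * (q ^ (d + 1) * x) - q * t⁻¹ * c = -(c * q * t⁻¹) * (1 - t * q ^ d * x) := by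
    field_simp
    ring
  have e3 : c * (q ^ (d + 1) * x) - c = -c * (1 - q ^ (d + 1) * x) := by ring
  have e4 : c * (q ^ (d + 1) * x) - t⁻¹ * c =
      -(c * t⁻¹) * (1 - t * q ^ (d + 1) * x) := by
    field_simp
    ring
  rw [e, e1, e2, e3, e4]
  field_simp

theorem prod_Ioc_gammaPlus (i n : ℕ) :
    ∏ j ∈ Finset.Ioc i (i + n), gammaPlus q t (q⁻¹ ^ i * z) (q⁻¹ ^ j * w) =
      (1 - t * z / w) / (1 - q * z / w) *
        ((1 - q ^ n * (q * z / w)) / (1 - q ^ n * (t * z / w))) := by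
  have hQ (k : ℕ) := one_sub_q_pow_mul_ne_zero k
  have hT (k : ℕ) := one_sub_t_mul_q_pow_mul_ne_zero k
  have key : ∏ j ∈ Finset.Ioc i (i + n), gammaPlus q t (q⁻¹ ^ i * z) (q⁻¹ ^ j * w) =
      (1 - t * q ^ 0 * (z / w)) / (1 - q ^ 1 * (z / w)) *
        ((1 - q ^ (n + 1) * (z / w)) / (1 - t * q ^ n * (z / w))) := by
    induction n with
    | zero =>
      have h1 := hQ 1
      have h2 := hT 0
      simp only [add_zero, Finset.Ioc_self, Finset.prod_empty, zero_add]
      rw [div_mul_div_comm, mul_comm, div_self (mul_ne_zero h1 h2)]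
    | succ n ih =>
      rw [← add_assoc, Finset.prod_Ioc_succ_top (by lia), ih, add_assoc, gammaPlus_q_inv_pow]
      have h1 := hQ 1
      have h2 := hQ (n + 1)
      have h3 := hT n
      have h4 := hT (n + 1)
      rw [div_mul_div_comm, div_mul_div_comm, div_mul_div_comm,
        div_eq_div_iff (by simp only [ne_eq, mul_eq_zero, not_or]; tauto)
          (mul_ne_zero h1 h4)]
      ring
  rw [key]
  congr 2 <;> ring

/-- `∏_{1≤i<j≤θ} γ₊(q^{-i}z, q^{-j}w; q,t)
  = ((1 - t z/w)/(1 - q z/w))^θ (q z/w;q)_θ / (t z/w;q)_θ`. -/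
theorem stmt0 (θ : ℕ) :
    (∏ i ∈ Finset.Icc 1 θ, ∏ j ∈ Finset.Ioc i θ,
        gammaPlus q t (q⁻¹ ^ i * z) (q⁻¹ ^ j * w))
    = ((1 - t * z / w) / (1 - q * z / w)) ^ θ
        * qPoch q (q * z / w) θ / qPoch q (t * z / w) θ := by
  have inner : ∀ i ∈ Finset.Icc 1 θ,
      ∏ j ∈ Finset.Ioc i θ, gammaPlus q t (q⁻¹ ^ i * z) (q⁻¹ ^ j * w) =
        (1 - t * z / w) / (1 - q * z / w) *
          ((1 - q ^ (θ - i) * (q * z / w)) / (1 - q ^ (θ - i) * (t * z / w))) := by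
    intro i hi
    rw [← prod_Ioc_gammaPlus i (θ - i), Nat.add_sub_cancel' (Finset.mem_Icc.mp hi).2]
  rw [Finset.prod_congr rfl inner, Finset.prod_mul_distrib, Finset.prod_const, Nat.card_Icc,
    Nat.add_sub_cancel, mul_div_assoc (_ ^ θ), qPoch, qPoch, ← Finset.prod_div_distrib]
  congr 1
  refine Finset.prod_nbij' (fun i => θ - i) (fun k => θ - k) ?_ ?_ ?_ ?_ fun _ _ => rfl <;>
    simp only [Finset.mem_Icc, Finset.mem_range] <;> lia

end
end

section
/- Let q, t, z, w be independent indeterminates over ℚ and work in the rational function field ℚ(q,t,z,w). For every natural number θ one has ∏_{1≤i<j≤θ} γ₋(q^{-i}z, q^{-j}w; q,t) = ((1 − z/w)/(1 − q t^{-1}·z/w))^θ · (q t^{-1}·z/w; q)_θ / (z/w; q)_θ. -/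
noncomputable section

/-- `γ₋(z,w;q,t) = (z - qw)(z - q⁻¹ t w)/((z - w)(z - t w))`. -/
def gammaMinus (q t zz ww : K) : K :=
  (zz - q * ww) * (zz - q⁻¹ * t * ww) / ((zz - ww) * (zz - t * ww))

theorem gammaMinus_shift {a b x y : K} (ha : a ≠ 0) (hb : b ≠ 0) (hy : y ≠ 0) (i n : ℕ) :
    gammaMinus a b (a⁻¹ ^ i * x) (a⁻¹ ^ (i + (n + 1)) * y) =
      (1 - a ^ n * (x / y)) * (1 - a ^ (n + 1) * (a * b⁻¹ * x / y)) /
        ((1 - a ^ (n + 1) * (x / y)) * (1 - a ^ n * (a * b⁻¹ * x / y))) := by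
  have hc : a⁻¹ ^ (i + (n + 1)) * y ≠ 0 := mul_ne_zero (pow_ne_zero _ (inv_ne_zero ha)) hy
  have hx : a⁻¹ ^ i * x = (a⁻¹ ^ (i + (n + 1)) * y) * (a ^ (n + 1) * (x / y)) := by
    rw [pow_add, inv_pow a (n + 1)]
    field_simp
  rw [hx]
  generalize a⁻¹ ^ (i + (n + 1)) * y = c at hc ⊢
  have hd : a * b⁻¹ * x / y = a * b⁻¹ * (x / y) := mul_div_assoc _ _ _
  rw [hd]
  generalize x / y = r
  have hb2 : c ^ 2 * b ≠ 0 := mul_ne_zero (pow_ne_zero _ hc) hb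
  rw [gammaMinus]
  conv_rhs => rw [← mul_div_mul_left _ _ hb2]
  congr 1 <;> (field_simp; ring)

/-- Telescoping product of the factors `gammaMinus` over one row. -/
theorem prod_gammaMinus_Ioc {a b x y : K} (ha : a ≠ 0) (hb : b ≠ 0) (hy : y ≠ 0)
    (h₁ : ∀ n : ℕ, 1 - a ^ n * (x / y) ≠ 0) (h₂ : ∀ n : ℕ, 1 - a ^ n * (a * b⁻¹ * x / y) ≠ 0)
    (i n : ℕ) :
    ∏ j ∈ Finset.Ioc i (i + n), gammaMinus a b (a⁻¹ ^ i * x) (a⁻¹ ^ j * y) =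
      (1 - x / y) / (1 - a * b⁻¹ * x / y) *
        ((1 - a ^ n * (a * b⁻¹ * x / y)) / (1 - a ^ n * (x / y))) := by
  induction n with
  | zero =>
    have h₁' := h₁ 0
    have h₂' := h₂ 0
    simp only [pow_zero, one_mul] at h₁' h₂'
    simp only [add_zero, Finset.Ioc_self, Finset.prod_empty, pow_zero, one_mul]
    rw [div_mul_div_cancel₀ h₂', div_self h₁']
  | succ n ih =>
    rw [← add_assoc, Finset.prod_Ioc_succ_top (by omega), ih, add_assoc,
      gammaMinus_shift ha hb hy, mul_assoc]
    congr 1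
    have h₁n := h₁ n
    have h₂n := h₂ n
    have h₁s := h₁ (n + 1)
    generalize 1 - a ^ n * (x / y) = A at *
    generalize 1 - a ^ n * (a * b⁻¹ * x / y) = B at *
    generalize 1 - a ^ (n + 1) * (x / y) = C at *
    field_simp

theorem prod_gammaMinus {a b x y : K} (ha : a ≠ 0) (hb : b ≠ 0) (hy : y ≠ 0)
    (h₁ : ∀ n : ℕ, 1 - a ^ n * (x / y) ≠ 0) (h₂ : ∀ n : ℕ, 1 - a ^ n * (a * b⁻¹ * x / y) ≠ 0)
    (θ : ℕ) :
    (∏ i ∈ Finset.Icc 1 θ, ∏ j ∈ Finset.Ioc i θ, gammaMinus a b (a⁻¹ ^ i * x) (a⁻¹ ^ j * y)) =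
      ((1 - x / y) / (1 - a * b⁻¹ * x / y)) ^ θ * qPoch a (a * b⁻¹ * x / y) θ /
        qPoch a (x / y) θ := by
  have row : ∀ i ∈ Finset.Icc 1 θ,
      ∏ j ∈ Finset.Ioc i θ, gammaMinus a b (a⁻¹ ^ i * x) (a⁻¹ ^ j * y) =
        (1 - x / y) / (1 - a * b⁻¹ * x / y) *
          ((1 - a ^ (θ - i) * (a * b⁻¹ * x / y)) / (1 - a ^ (θ - i) * (x / y))) := by
    intro i hi
    rw [← prod_gammaMinus_Ioc ha hb hy h₁ h₂, Nat.add_sub_cancel' (Finset.mem_Icc.mp hi).2]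
  rw [Finset.prod_congr rfl row, Finset.prod_mul_distrib, Finset.prod_const, Nat.card_Icc,
    Nat.add_sub_cancel, mul_div_assoc (_ ^ θ), qPoch, qPoch, ← Finset.prod_div_distrib]
  congr 1
  refine Finset.prod_bij' (fun i _ => θ - i) (fun i _ => θ - i) ?_ ?_ ?_ ?_ ?_ <;>
    simp only [Finset.mem_Icc, Finset.mem_range] <;> intros <;> first | trivial | omega

theorem algebraMap_ne_zero_of_eval {p : MvPolynomial (Fin 4) ℚ} (v : Fin 4 → ℚ)
    (h : MvPolynomial.eval v p ≠ 0) : algebraMap (MvPolynomial (Fin 4) ℚ) K p ≠ 0 := by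
  rw [Ne, IsFractionRing.to_map_eq_zero_iff]
  rintro rfl
  exact h (map_zero _)

theorem w_sub_ne_zero (n : ℕ) : w - q ^ n * z ≠ 0 := by
  rw [w, q, z, ← map_pow, ← map_mul, ← map_sub]
  exact algebraMap_ne_zero_of_eval
    (p := MvPolynomial.X 3 - MvPolynomial.X 0 ^ n * MvPolynomial.X 2) ![1, 1, 0, 1] (by simp)

theorem t_mul_w_sub_ne_zero (n : ℕ) : t * w - q ^ n * z ≠ 0 := by
  rw [t, w, q, z, ← map_pow, ← map_mul, ← map_mul, ← map_sub]
  exact algebraMap_ne_zero_of_eval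
    (p := MvPolynomial.X 1 * MvPolynomial.X 3 - MvPolynomial.X 0 ^ n * MvPolynomial.X 2)
    ![1, 1, 0, 1] (by simp)

/-- `∏_{1≤i<j≤θ} γ₋(q^{-i}z, q^{-j}w; q,t)
  = ((1 - z/w)/(1 - q t⁻¹ z/w))^θ (q t⁻¹ z/w;q)_θ / (z/w;q)_θ`. -/
theorem stmt1 (θ : ℕ) :
    (∏ i ∈ Finset.Icc 1 θ, ∏ j ∈ Finset.Ioc i θ,
        gammaMinus q t (q⁻¹ ^ i * z) (q⁻¹ ^ j * w))
    = ((1 - z / w) / (1 - q * t⁻¹ * z / w)) ^ θ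
        * qPoch q (q * t⁻¹ * z / w) θ / qPoch q (z / w) θ := by
  have hw := w_ne_zero
  have ht := t_ne_zero
  refine prod_gammaMinus q_ne_zero ht hw (fun n => ?_) (fun n => ?_) θ
  · have h : 1 - q ^ n * (z / w) = (w - q ^ n * z) / w := by field_simp
    rw [h]
    exact div_ne_zero (w_sub_ne_zero n) hw
  · have h : 1 - q ^ n * (q * t⁻¹ * z / w) = (t * w - q ^ (n + 1) * z) / (t * w) := by
      field_simp
      ring
    rw [h]
    exact div_ne_zero (t_mul_w_sub_ne_zero (n + 1)) (mul_ne_zero ht hw)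

end
end

section
/- Let q, t, z, w be independent indeterminates over ℚ and work in the rational function field ℚ(q,t,z,w). For all natural numbers θ, ρ one has ∏_{l=1}^{θ} ∏_{k=1}^{ρ} γ₋(q^{-l}z, q^{-k}w; q,t) = (q·w/z; q)_θ · (q^{-ρ} t·w/z; q)_θ / ( (q^{-ρ+1}·w/z; q)_θ · (t·w/z; q)_θ ). -/
noncomputable section

theorem z_ne_zero : z ≠ 0 := by
  simp [z]

/-- No relation `qᵃ z = qᵇ tᶜ w` holds: specialise to `q = t = w = 1`, `z = 2`. -/
theorem pow_mul_z_ne (a b c : ℕ) : q ^ a * z ≠ q ^ b * t ^ c * w := by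
  intro h
  simp only [q, t, z, w, ← map_pow, ← map_mul] at h
  have h' := IsFractionRing.injective (MvPolynomial (Fin 4) ℚ) K h
  have he := congrArg (MvPolynomial.eval ![1, 1, 2, 1]) h'
  simp at he

theorem one_sub_zpow_mul_ne_zero (n : ℤ) (c : ℕ) : 1 - q ^ n * (t ^ c * (w / z)) ≠ 0 := by
  have hq := q_ne_zero
  have hz := z_ne_zero
  intro h
  obtain ⟨a, b, rfl⟩ : ∃ a b : ℕ, n = (b : ℤ) - a := ⟨(-n).toNat, n.toNat, by omega⟩
  apply pow_mul_z_ne a b c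
  rw [zpow_sub₀ hq, zpow_natCast, zpow_natCast] at h
  field_simp at h
  linear_combination h

theorem gammaMinus_eq_div_mul_div (l k : ℕ) :
    gammaMinus q t (q⁻¹ ^ l * z) (q⁻¹ ^ (k + 1) * w) =
      ((1 - q ^ ((l : ℤ) - (k + 1 : ℕ)) * (w / z)) / (1 - q ^ ((l : ℤ) - k) * (w / z)))⁻¹ *
      ((1 - q ^ ((l : ℤ) - (k + 1 : ℕ) - 1) * (t * (w / z))) /
        (1 - q ^ ((l : ℤ) - k - 1) * (t * (w / z)))) := by
  have hq := q_ne_zero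
  have hz := z_ne_zero
  have factor (x y : K) (n : ℤ) (hx : x = q⁻¹ ^ l * z * (q ^ n * y)) :
      q⁻¹ ^ l * z - x = q⁻¹ ^ l * z * (1 - q ^ n * y) := by rw [hx]; ring
  have h0 : q⁻¹ ^ l * z ≠ 0 := by positivity
  rw [gammaMinus,
    factor _ (w / z) ((l : ℤ) - k), factor _ (t * (w / z)) ((l : ℤ) - (k + 1 : ℕ) - 1),
    factor _ (w / z) ((l : ℤ) - (k + 1 : ℕ)), factor _ (t * (w / z)) ((l : ℤ) - k - 1)]
  · rw [inv_div, div_mul_div_comm, mul_mul_mul_comm (q⁻¹ ^ l * z) _ (q⁻¹ ^ l * z),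
      mul_mul_mul_comm (q⁻¹ ^ l * z) _ (q⁻¹ ^ l * z),
      mul_div_mul_left _ _ (mul_ne_zero h0 h0)]
  all_goals
    simp only [zpow_sub₀ hq, zpow_natCast, zpow_one, inv_pow, pow_succ]
    field_simp

theorem prod_range_div_of_ne_zero {F : Type*} [Field F] (f : ℕ → F) (hf : ∀ n, f n ≠ 0) (n : ℕ) :
    ∏ i ∈ Finset.range n, f (i + 1) / f i = f n / f 0 := by
  induction n with
  | zero => simp [hf 0]
  | succ n ih => rw [Finset.prod_range_succ, ih, mul_comm, div_mul_div_cancel₀ (hf n)]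

theorem prod_gammaMinus_column (l ρ : ℕ) :
    ∏ k ∈ Finset.Icc 1 ρ, gammaMinus q t (q⁻¹ ^ l * z) (q⁻¹ ^ k * w) =
      (1 - q ^ (l : ℤ) * (w / z)) * (1 - q ^ ((l : ℤ) - ρ - 1) * (t * (w / z))) /
      ((1 - q ^ ((l : ℤ) - ρ) * (w / z)) * (1 - q ^ ((l : ℤ) - 1) * (t * (w / z)))) := by
  have hu (n : ℤ) : 1 - q ^ n * (w / z) ≠ 0 := by
    simpa using one_sub_zpow_mul_ne_zero n 0
  have hv (n : ℤ) : 1 - q ^ n * (t * (w / z)) ≠ 0 := by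
    simpa using one_sub_zpow_mul_ne_zero n 1
  rw [← Finset.Ico_add_one_right_eq_Icc, Finset.prod_Ico_eq_prod_range, Nat.add_sub_cancel]
  simp only [add_comm 1, gammaMinus_eq_div_mul_div, Finset.prod_mul_distrib, Finset.prod_inv_distrib]
  rw [prod_range_div_of_ne_zero (fun k : ℕ => 1 - q ^ ((l : ℤ) - k) * (w / z)) (fun _ => hu _),
    prod_range_div_of_ne_zero (fun k : ℕ => 1 - q ^ ((l : ℤ) - k - 1) * (t * (w / z))) (fun _ => hv _)]
  simp only [Nat.cast_zero, sub_zero]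
  rw [inv_div, div_mul_div_comm]

/-- `∏_{l=1}^θ ∏_{k=1}^ρ γ₋(q^{-l}z, q^{-k}w; q,t)
  = (q w/z;q)_θ (q^{-ρ} t w/z;q)_θ / ((q^{-ρ+1} w/z;q)_θ (t w/z;q)_θ)`. -/
theorem stmt4 (θ ρ : ℕ) :
    (∏ l ∈ Finset.Icc 1 θ, ∏ k ∈ Finset.Icc 1 ρ,
        gammaMinus q t (q⁻¹ ^ l * z) (q⁻¹ ^ k * w))
    = qPoch q (q * (w / z)) θ * qPoch q (q ^ (-(ρ : ℤ)) * t * (w / z)) θ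
        / (qPoch q (q ^ ((1 : ℤ) - ρ) * (w / z)) θ * qPoch q (t * (w / z)) θ) := by
  have hq := q_ne_zero
  simp only [prod_gammaMinus_column, qPoch]
  rw [← Finset.Ico_add_one_right_eq_Icc, Finset.prod_Ico_eq_prod_range, Nat.add_sub_cancel,
    ← Finset.prod_mul_distrib, ← Finset.prod_mul_distrib, ← Finset.prod_div_distrib]
  refine Finset.prod_congr rfl fun i _ => ?_
  have shift (n m : ℤ) (y : K) (h : n = i + m) : q ^ n * y = q ^ i * (q ^ m * y) := by
    rw [h, zpow_add₀ hq, zpow_natCast, mul_assoc]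
  rw [shift (1 + i : ℕ) 1 _ (by push_cast; ring),
    shift ((1 + i : ℕ) - ρ - 1) (-(ρ : ℤ)) _ (by push_cast; ring),
    shift ((1 + i : ℕ) - ρ) (1 - (ρ : ℤ)) _ (by push_cast; ring),
    shift ((1 + i : ℕ) - 1) 0 _ (by push_cast; ring)]
  simp only [zpow_one, zpow_zero, one_mul, mul_assoc]

end
end

section
/- Let q, t, z, w be independent indeterminates over ℚ and work in the rational function field ℚ(q,t,z,w). For all natural numbers θ, ρ one has ∏_{l=1}^{θ} ∏_{k=1}^{ρ} γ₋(q^{-l}z, q^{-k}w; q,t) = (q^{-θ}·z/w; q)_θ · (q^{ρ−θ+1} t^{-1}·z/w; q)_θ / ( (q^{ρ−θ}·z/w; q)_θ · (q^{-θ+1} t^{-1}·z/w; q)_θ ). -/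
noncomputable section

theorem algebraMap_ne_of_eval_ne {p r : MvPolynomial (Fin 4) ℚ} (v : Fin 4 → ℚ)
    (h : MvPolynomial.eval v p ≠ MvPolynomial.eval v r) :
    algebraMap (MvPolynomial (Fin 4) ℚ) K p ≠ algebraMap (MvPolynomial (Fin 4) ℚ) K r :=
  fun hpr => h (congrArg _ (IsFractionRing.injective (MvPolynomial (Fin 4) ℚ) K hpr))

open MvPolynomial in
theorem q_zpow_mul_z_ne_w (n : ℤ) : q ^ n * z ≠ w := by
  have hq := q_ne_zero
  obtain ⟨m, rfl | rfl⟩ := n.eq_nat_or_neg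
  · have := algebraMap_ne_of_eval_ne (p := X 0 ^ m * X 2) (r := X 3) ![1, 1, 0, 1] (by simp)
    simpa [q, z, w] using this
  · have := algebraMap_ne_of_eval_ne (p := X 2) (r := X 0 ^ m * X 3) ![1, 1, 0, 1] (by simp)
    rw [zpow_neg, zpow_natCast, Ne, inv_mul_eq_iff_eq_mul₀ (pow_ne_zero m hq)]
    simpa [q, z, w] using this

open MvPolynomial in
theorem q_zpow_mul_z_ne_t_mul_w (n : ℤ) : q ^ n * z ≠ t * w := by
  have hq := q_ne_zero
  obtain ⟨m, rfl | rfl⟩ := n.eq_nat_or_neg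
  · have := algebraMap_ne_of_eval_ne (p := X 0 ^ m * X 2) (r := X 1 * X 3) ![1, 1, 0, 1] (by simp)
    simpa [q, t, z, w] using this
  · have := algebraMap_ne_of_eval_ne (p := X 2) (r := X 0 ^ m * (X 1 * X 3)) ![1, 1, 0, 1]
      (by simp)
    rw [zpow_neg, zpow_natCast, Ne, inv_mul_eq_iff_eq_mul₀ (pow_ne_zero m hq)]
    simpa [q, t, z, w] using this

theorem one_sub_q_zpow_mul_ne_zero (n : ℤ) : 1 - q ^ n * (z / w) ≠ 0 := by
  rw [← mul_div_assoc, sub_ne_zero, ne_comm, Ne, div_eq_one_iff_eq w_ne_zero]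
  exact q_zpow_mul_z_ne_w n

theorem one_sub_q_zpow_mul_inv_t_mul_ne_zero (n : ℤ) : 1 - q ^ n * t⁻¹ * (z / w) ≠ 0 := by
  have ht := t_ne_zero
  have hw := w_ne_zero
  have h : q ^ n * t⁻¹ * (z / w) = q ^ n * z / (t * w) := by field_simp
  rw [h, sub_ne_zero, ne_comm, Ne, div_eq_one_iff_eq (mul_ne_zero ht hw)]
  exact q_zpow_mul_z_ne_t_mul_w n

theorem gammaMinus_mul_left {q t b : K} (u : K) (hq : q ≠ 0) (ht : t ≠ 0) (hb : b ≠ 0) :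
    gammaMinus q t (u * b) b
      = (1 - q⁻¹ * u) * (1 - q * t⁻¹ * u) / ((1 - u) * (1 - t⁻¹ * u)) := by
  have hnum : (u * b - q * b) * (u * b - q⁻¹ * t * b)
      = b ^ 2 * t * ((1 - q⁻¹ * u) * (1 - q * t⁻¹ * u)) := by
    field_simp
    ring
  have hden : (u * b - b) * (u * b - t * b) = b ^ 2 * t * ((1 - u) * (1 - t⁻¹ * u)) := by
    field_simp
    ring
  rw [gammaMinus, hnum, hden, mul_div_mul_left _ _ (mul_ne_zero (pow_ne_zero 2 hb) ht)]

theorem gammaMinus_q_inv_pow (l k : ℕ) :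
    gammaMinus q t (q⁻¹ ^ l * z) (q⁻¹ ^ k * w)
      = (1 - q ^ ((k : ℤ) - 1 - l) * (z / w)) * (1 - q ^ ((k : ℤ) + 1 - l) * t⁻¹ * (z / w))
        / ((1 - q ^ ((k : ℤ) - l) * (z / w)) * (1 - q ^ ((k : ℤ) - l) * t⁻¹ * (z / w))) := by
  have hq := q_ne_zero
  have hw := w_ne_zero
  have hz : q⁻¹ ^ l * z = q ^ ((k : ℤ) - l) * (z / w) * (q⁻¹ ^ k * w) := by
    rw [zpow_sub₀ hq, zpow_natCast, zpow_natCast, inv_pow, inv_pow]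
    field_simp
  have h₁ : q ^ ((k : ℤ) - 1 - l) = q⁻¹ * q ^ ((k : ℤ) - l) := by
    rw [← zpow_neg_one, ← zpow_add₀ hq]
    ring_nf
  have h₂ : q ^ ((k : ℤ) + 1 - l) = q * q ^ ((k : ℤ) - l) := by
    rw [← zpow_one_add₀ hq]
    ring_nf
  rw [hz, gammaMinus_mul_left _ hq t_ne_zero (mul_ne_zero (pow_ne_zero k (inv_ne_zero hq)) hw),
    h₁, h₂]
  ring_nf

theorem prod_gammaMinus_q_inv_pow (l ρ : ℕ) :
    ∏ k ∈ Finset.Icc 1 ρ, gammaMinus q t (q⁻¹ ^ l * z) (q⁻¹ ^ k * w)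
      = (1 - q ^ (-(l : ℤ)) * (z / w)) * (1 - q ^ ((ρ : ℤ) - l + 1) * t⁻¹ * (z / w))
        / ((1 - q ^ ((ρ : ℤ) - l) * (z / w)) * (1 - q ^ ((1 : ℤ) - l) * t⁻¹ * (z / w))) := by
  induction ρ with
  | zero =>
    have h := mul_ne_zero (one_sub_q_zpow_mul_ne_zero (-l))
      (one_sub_q_zpow_mul_inv_t_mul_ne_zero (1 - l))
    simp only [Nat.cast_zero, zero_sub, neg_add_eq_sub]
    rw [div_self h]
    simp
  | succ ρ ih =>
    rw [Finset.prod_Icc_succ_top (by lia), ih, gammaMinus_q_inv_pow]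
    have e₁ : ((ρ + 1 : ℕ) : ℤ) - 1 - l = ρ - l := by lia
    have e₂ : ((ρ + 1 : ℕ) : ℤ) + 1 - l = (ρ + 1 : ℕ) - l + 1 := by lia
    have e₃ : (ρ : ℤ) - l + 1 = (ρ + 1 : ℕ) - l := by lia
    rw [e₁, e₂, e₃]
    have h₁ := one_sub_q_zpow_mul_ne_zero (ρ - l)
    have h₂ := one_sub_q_zpow_mul_ne_zero ((ρ + 1 : ℕ) - l)
    have h₃ := one_sub_q_zpow_mul_inv_t_mul_ne_zero ((ρ + 1 : ℕ) - l)
    have h₄ := one_sub_q_zpow_mul_inv_t_mul_ne_zero (1 - l)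
    rw [div_mul_div_comm, div_eq_div_iff (by simp only [ne_eq, mul_eq_zero, not_or]; tauto)
      (mul_ne_zero h₂ h₄)]
    ring

theorem qPoch_q_zpow_sub_mul (n : ℤ) (c : K) (θ : ℕ) :
    qPoch q (q ^ (n - θ) * c) θ = ∏ l ∈ Finset.Icc 1 θ, (1 - q ^ (n - l) * c) := by
  rw [qPoch, ← Finset.prod_range_reflect, ← Finset.Ico_add_one_right_eq_Icc,
    Finset.prod_Ico_eq_prod_range]
  refine Finset.prod_congr (by simp) fun i hi => ?_
  have hi := Finset.mem_range.mp hi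
  rw [← mul_assoc, ← zpow_natCast, ← zpow_add₀ q_ne_zero]
  congr 3
  grind

/-- `∏_{l=1}^θ ∏_{k=1}^ρ γ₋(q^{-l}z, q^{-k}w; q,t)
  = (q^{-θ} z/w;q)_θ (q^{ρ-θ+1} t⁻¹ z/w;q)_θ / ((q^{ρ-θ} z/w;q)_θ (q^{-θ+1} t⁻¹ z/w;q)_θ)`. -/
theorem stmt5 (θ ρ : ℕ) :
    (∏ l ∈ Finset.Icc 1 θ, ∏ k ∈ Finset.Icc 1 ρ,
        gammaMinus q t (q⁻¹ ^ l * z) (q⁻¹ ^ k * w))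
    = qPoch q (q ^ (-(θ : ℤ)) * (z / w)) θ
        * qPoch q (q ^ ((ρ : ℤ) - θ + 1) * t⁻¹ * (z / w)) θ
        / (qPoch q (q ^ ((ρ : ℤ) - θ) * (z / w)) θ
            * qPoch q (q ^ ((1 : ℤ) - θ) * t⁻¹ * (z / w)) θ) := by
  have h₁ := qPoch_q_zpow_sub_mul 0 (z / w) θ
  have h₂ := qPoch_q_zpow_sub_mul (ρ + 1) (t⁻¹ * (z / w)) θ
  have h₃ := qPoch_q_zpow_sub_mul ρ (z / w) θ
  have h₄ := qPoch_q_zpow_sub_mul 1 (t⁻¹ * (z / w)) θ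
  simp only [zero_sub, add_sub_right_comm, ← mul_assoc] at h₁ h₂ h₃ h₄
  simp only [h₁, h₂, h₃, h₄, prod_gammaMinus_q_inv_pow, Finset.prod_div_distrib,
    Finset.prod_mul_distrib]

end
end

section
/- Let F be a field, let m ≥ 1 be an integer, let P ∈ F with P ≠ 0 and P^m ≠ 1, and set A := (1 − P^{-1})/(1 − P^m). Then for every i with 1 ≤ i ≤ m one has A^2 · Σ_{k=1}^{m} P^{2m−k+1} + (1 − P^{-1}) A · Σ_{k=1}^{i−1} P^{m−k+1} + A P^{m} + A P^{m−i+1} + 1 = (1 − P^{m−1})/(1 − P^{m}). -/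
/-- Telescoping of the geometric progression `P ^ N, P ^ (N - 1), …, P ^ (N - n + 1)`. -/
theorem one_sub_inv_mul_sum_pow_sub {F : Type*} [Field F] {P : F} (hP : P ≠ 0) {N n : ℕ}
    (hn : n ≤ N) :
    (1 - P⁻¹) * ∑ k ∈ Finset.Icc 1 n, P ^ (N - k + 1) = P ^ N - P ^ (N - n) := by
  induction n with
  | zero => simp
  | succ n ih =>
    rw [Finset.sum_Icc_succ_top (by omega), mul_add, ih (by omega),
      show N - n = N - (n + 1) + 1 by omega, pow_succ]
    field_simp
    ring


/-- the diagonal (i = j) normal-ordering coefficient identity for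
`f_{1,m}(w/z) Λ_i(z) Λ_i(w) = :Λ_i(z)Λ_i(w):` in a general field. -/
theorem stmt13 {F : Type*} [Field F] (m : ℕ) (hm : 1 ≤ m) (P : F) (hP : P ≠ 0)
    (hPm : P ^ m ≠ 1) (i : ℕ) (hi1 : 1 ≤ i) (him : i ≤ m) :
    ((1 - P⁻¹) / (1 - P ^ m)) ^ 2 * (∑ k ∈ Finset.Icc 1 m, P ^ (2 * m - k + 1))
      + (1 - P⁻¹) * ((1 - P⁻¹) / (1 - P ^ m)) *
          (∑ k ∈ Finset.Icc 1 (i - 1), P ^ (m - k + 1))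
      + ((1 - P⁻¹) / (1 - P ^ m)) * P ^ m
      + ((1 - P⁻¹) / (1 - P ^ m)) * P ^ (m - i + 1)
      + 1
    = (1 - P ^ (m - 1)) / (1 - P ^ m) := by
  have hD : 1 - P ^ m ≠ 0 := sub_ne_zero.mpr hPm.symm
  have h₁ := one_sub_inv_mul_sum_pow_sub hP (show m ≤ 2 * m by omega)
  have h₂ := one_sub_inv_mul_sum_pow_sub hP (show i - 1 ≤ m by omega)
  rw [show 2 * m - m = m by omega] at h₁
  rw [show m - (i - 1) = m - i + 1 by omega] at h₂
  have hA : (1 - P⁻¹) / (1 - P ^ m) * (1 - P ^ m) = 1 - P⁻¹ := div_mul_cancel₀ _ hD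
  have hpow : P⁻¹ * P ^ m = P ^ (m - 1) := by
    rw [← Nat.sub_add_cancel hm, pow_succ, Nat.add_sub_cancel]
    field_simp
  rw [eq_div_iff hD]
  set A := (1 - P⁻¹) / (1 - P ^ m)
  linear_combination A * h₁ + A * (1 - P ^ m) * h₂ - hpow
    + (P ^ m + A * ∑ k ∈ Finset.Icc 1 m, P ^ (2 * m - k + 1)) * hA
end
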